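/- arXiv:1301.6540 — 2 statements merged into one kernel-verified Lean document; each statement's English description precedes it below -/
import Mathlib

section
/- For all integers n ≥ k ≥ 1, the average of the linear crossing number over partitions of [n] into k blocks satisfies E(X_{n,k}) = (1/2)·n·(k−1) − (5/4)·k·(k−1) + (3/2)·(n+1−k)·S(n,k−1)/S(n,k); equivalently, Σ_{π∈Π_n^k} cr^ℓ(π) = (1/2)n(k−1)·S(n,k) − (5/4)k(k−1)·S(n,k) + (3/2)(n+1−k)·S(n,k−1). -/
open Finset

/-- Two elements lie in the same block of the set partition `π` of `[n]`. -/
def sameBlock {n : ℕ} (π : Finpartition (univ : Finset (Fin n))) (a b : Fin n) : Prop :=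
  ∃ B ∈ π.parts, a ∈ B ∧ b ∈ B

/-- `(a, b)` is an arc of `π`: `a < b`, they lie in a common block, and no element of that
block lies strictly between them. -/
def IsArc {n : ℕ} (π : Finpartition (univ : Finset (Fin n))) (a b : Fin n) : Prop :=
  a < b ∧ sameBlock π a b ∧ ∀ c : Fin n, a < c → c < b → ¬ sameBlock π a c

/-- The linear crossing number `cr^ℓ(π)`: the number of pairs of arcs
`((a,b),(c,d))` with `a < c < b < d`. -/
noncomputable def crl {n : ℕ} (π : Finpartition (univ : Finset (Fin n))) : ℕ :=
  Set.ncard {q : (Fin n × Fin n) × (Fin n × Fin n) |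
    IsArc π q.1.1 q.1.2 ∧ IsArc π q.2.1 q.2.2 ∧
    q.1.1 < q.2.1 ∧ q.2.1 < q.1.2 ∧ q.1.2 < q.2.2}

/-- `(a, b)` is a chord of `π`: `a < b` lie in a common block `B`, and either they are
consecutive elements of `B`, or `B` has at least 3 elements and `a = min B`, `b = max B`. -/
def IsChord {n : ℕ} (π : Finpartition (univ : Finset (Fin n))) (a b : Fin n) : Prop :=
  a < b ∧ ∃ B ∈ π.parts, a ∈ B ∧ b ∈ B ∧
    ((∀ c ∈ B, ¬(a < c ∧ c < b)) ∨ (3 ≤ B.card ∧ ∀ c ∈ B, a ≤ c ∧ c ≤ b))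

/-- The circular crossing number `cr^c(π)`: the number of unordered pairs of crossing chords,
counted as ordered pairs `((a,b),(c,d))` of chords with `a < c < b < d`. -/
noncomputable def crc {n : ℕ} (π : Finpartition (univ : Finset (Fin n))) : ℕ :=
  Set.ncard {q : (Fin n × Fin n) × (Fin n × Fin n) |
    IsChord π q.1.1 q.1.2 ∧ IsChord π q.2.1 q.2.2 ∧
    q.1.1 < q.2.1 ∧ q.2.1 < q.1.2 ∧ q.1.2 < q.2.2}

/-- The Stirling number of the second kind `S(n,k)`: the number of set partitions of `[n]`
into exactly `k` blocks. -/
noncomputable def stirling (n k : ℕ) : ℕ :=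
  Nat.card {π : Finpartition (univ : Finset (Fin n)) // π.parts.card = k}

/-- Stirling numbers with integer arguments: `S(m,j) = 0` unless `0 ≤ j ≤ m`. -/
noncomputable def stirlingZ (m j : ℤ) : ℕ :=
  if 0 ≤ m ∧ 0 ≤ j then stirling m.toNat j.toNat else 0

/-- The Bell number `B_n`: the number of set partitions of `[n]`. -/
noncomputable def bell (n : ℕ) : ℕ :=
  Nat.card (Finpartition (univ : Finset (Fin n)))

/-- The set partitions of `[n]` with exactly `k` blocks, as a `Finset`. -/
def Pik (n k : ℕ) : Finset (Finpartition (univ : Finset (Fin n))) :=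
  Finset.univ.filter fun π => π.parts.card = k

/-- The mean of the linear crossing number over `Π_n^k`. -/
noncomputable def EX (n k : ℕ) : ℝ :=
  (∑ π ∈ Pik n k, (crl π : ℝ)) / stirling n k

/-- The variance of the linear crossing number over `Π_n^k`. -/
noncomputable def VarX (n k : ℕ) : ℝ :=
  (∑ π ∈ Pik n k, (crl π : ℝ) ^ 2) / stirling n k - EX n k ^ 2

/-- The mean of the circular crossing number over `Π_n^k`. -/
noncomputable def EY (n k : ℕ) : ℝ :=
  (∑ π ∈ Pik n k, (crc π : ℝ)) / stirling n k

/-- The variance of the circular crossing number over `Π_n^k`. -/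
noncomputable def VarY (n k : ℕ) : ℝ :=
  (∑ π ∈ Pik n k, (crc π : ℝ) ^ 2) / stirling n k - EY n k ^ 2

/-- The mean of the linear crossing number over all of `Π_n`. -/
noncomputable def EXall (n : ℕ) : ℝ :=
  (∑ π : Finpartition (univ : Finset (Fin n)), (crl π : ℝ)) / bell n

/-- The variance of the linear crossing number over all of `Π_n`. -/
noncomputable def VarXall (n : ℕ) : ℝ :=
  (∑ π : Finpartition (univ : Finset (Fin n)), (crl π : ℝ) ^ 2) / bell n - EXall n ^ 2

/-- The mean of the circular crossing number over all of `Π_n`. -/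
noncomputable def EYall (n : ℕ) : ℝ :=
  (∑ π : Finpartition (univ : Finset (Fin n)), (crc π : ℝ)) / bell n

/-- The variance of the circular crossing number over all of `Π_n`. -/
noncomputable def VarYall (n : ℕ) : ℝ :=
  (∑ π : Finpartition (univ : Finset (Fin n)), (crc π : ℝ) ^ 2) / bell n - EYall n ^ 2

/-- The standard normal distribution function `Φ`. -/
noncomputable def stdNormalCDF (x : ℝ) : ℝ :=
  (Real.sqrt (2 * Real.pi))⁻¹ * ∫ t in Set.Iic x, Real.exp (-t ^ 2 / 2)

section SameBlock

variable {n : ℕ} {π σ : Finpartition (univ : Finset (Fin n))} {a b c : Fin n}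

theorem sameBlock_iff_part_eq : sameBlock π a b ↔ π.part a = π.part b := by
  rw [← π.mem_part_iff_part_eq_part (mem_univ a) (mem_univ b), π.mem_part_iff_exists]
  rfl

theorem sameBlock.symm (h : sameBlock π a b) : sameBlock π b a := by
  rw [sameBlock_iff_part_eq] at *
  exact h.symm

theorem sameBlock.trans (h : sameBlock π a b) (h' : sameBlock π b c) : sameBlock π a c := by
  rw [sameBlock_iff_part_eq] at *
  exact h.trans h'

theorem sameBlock_self (a : Fin n) : sameBlock π a a :=
  sameBlock_iff_part_eq.2 rfl

theorem mem_part_iff_sameBlock : a ∈ π.part b ↔ sameBlock π a b :=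
  π.mem_part_iff_exists

theorem finpartition_ext_sameBlock (h : ∀ a b, sameBlock π a b ↔ sameBlock σ a b) : π = σ := by
  have part_eq (a : Fin n) : π.part a = σ.part a := by
    ext b
    rw [mem_part_iff_sameBlock, mem_part_iff_sameBlock, h]
  ext B
  constructor <;> intro hB
  · obtain ⟨a, ha⟩ := π.nonempty_of_mem_parts hB
    rw [← π.part_eq_of_mem hB ha, part_eq]
    exact σ.part_mem.2 (mem_univ a)
  · obtain ⟨a, ha⟩ := σ.nonempty_of_mem_parts hB
    rw [← σ.part_eq_of_mem hB ha, ← part_eq]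
    exact π.part_mem.2 (mem_univ a)

open Classical in
theorem sameBlock_ofSetoid (s : Setoid (Fin n)) :
    sameBlock (Finpartition.ofSetoid s) a b ↔ s a b := by
  rw [← mem_part_iff_sameBlock, Finpartition.mem_part_ofSetoid_iff_rel]
  exact ⟨s.symm, s.symm⟩

end SameBlock

section Statistics

variable {n : ℕ} (π : Finpartition (univ : Finset (Fin n)))

open Classical in
/-- The largest elements of the blocks of `π`. -/
noncomputable def blockMaxes : Finset (Fin n) :=
  univ.filter fun a => ∀ b, a < b → ¬ sameBlock π a b

open Classical in
/-- The smallest elements of the blocks of `π`. -/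
noncomputable def blockMins : Finset (Fin n) :=
  univ.filter fun a => ∀ b, b < a → ¬ sameBlock π a b

open Classical in
/-- The arcs of `π`. -/
noncomputable def arcs : Finset (Fin n × Fin n) :=
  univ.filter fun p => IsArc π p.1 p.2

/-- The number of pairs of blocks `(B, C)` with `max B < min C`. -/
noncomputable def separatedPairs : ℕ :=
  ∑ a ∈ blockMaxes π, #{b ∈ blockMins π | a < b}

variable {π}

theorem mem_blockMaxes {a : Fin n} :
    a ∈ blockMaxes π ↔ ∀ b, a < b → ¬ sameBlock π a b := by
  simp [blockMaxes]

theorem mem_blockMins {a : Fin n} :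
    a ∈ blockMins π ↔ ∀ b, b < a → ¬ sameBlock π a b := by
  simp [blockMins]

theorem mem_arcs {p : Fin n × Fin n} : p ∈ arcs π ↔ IsArc π p.1 p.2 := by
  simp [arcs]

theorem eq_of_sameBlock_of_mem_blockMaxes {a b : Fin n} (ha : a ∈ blockMaxes π)
    (hb : b ∈ blockMaxes π) (h : sameBlock π a b) : a = b := by
  rw [mem_blockMaxes] at ha hb
  rcases lt_trichotomy a b with hab | hab | hab
  · exact absurd h (ha b hab)
  · exact hab
  · exact absurd h.symm (hb a hab)

theorem card_parts_eq_card_blockMaxes : #π.parts = #(blockMaxes π) := by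
  symm
  refine card_bij (fun a _ => π.part a) (fun a _ => π.part_mem.2 (mem_univ a))
    (fun a ha b hb h =>
      eq_of_sameBlock_of_mem_blockMaxes ha hb (sameBlock_iff_part_eq.2 h)) fun B hB => ?_
  have hne := π.nonempty_of_mem_parts hB
  refine ⟨B.max' hne, mem_blockMaxes.2 fun b hb h => ?_, π.part_eq_of_mem hB (B.max'_mem hne)⟩
  have hbB : b ∈ B := by
    rw [← π.part_eq_of_mem hB (B.max'_mem hne), mem_part_iff_sameBlock]
    exact h.symm
  exact absurd (B.le_max' b hbB) (not_le.2 hb)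

theorem crl_eq_sum_arcs :
    crl π = ∑ p ∈ arcs π, #{q ∈ arcs π | q.1 < p.1 ∧ p.1 < q.2 ∧ q.2 < p.2} := by
  classical
  rw [← card_sigma, crl, Set.ncard_eq_toFinset_card']
  refine card_bij (fun q _ => ⟨q.2, q.1⟩) (fun q hq => ?_) (fun q _ q' _ h => ?_)
    fun q hq => ⟨(q.2, q.1), ?_, rfl⟩
  · simpa [mem_arcs, and_assoc, and_left_comm] using hq
  · simpa [Prod.ext_iff, and_comm] using h
  · simpa [mem_arcs, and_assoc, and_left_comm] using hq

theorem exists_isArc_right {a b : Fin n} (hab : a < b) (h : sameBlock π a b) :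
    ∃ c, IsArc π a c := by
  classical
  obtain ⟨c, hc, hmin⟩ := exists_min_image (univ.filter fun c => a < c ∧ sameBlock π a c) id
    ⟨b, by simp [hab, h]⟩
  simp only [mem_filter, mem_univ, true_and, id] at hc hmin
  exact ⟨c, hc.1, hc.2, fun d had hdc hd => absurd (hmin d ⟨had, hd⟩) (not_le.2 hdc)⟩

theorem exists_isArc_left {a b : Fin n} (hab : b < a) (h : sameBlock π a b) :
    ∃ c, IsArc π c a := by
  classical
  obtain ⟨c, hc, hmax⟩ := exists_max_image (univ.filter fun c => c < a ∧ sameBlock π a c) id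
    ⟨b, by simp [hab, h]⟩
  simp only [mem_filter, mem_univ, true_and, id] at hc hmax
  exact ⟨c, hc.1, hc.2.symm, fun d hcd hda hd =>
    absurd (hmax d ⟨hda, hc.2.trans hd⟩) (not_le.2 hcd)⟩

theorem IsArc.right_unique {a b c : Fin n} (hb : IsArc π a b) (hc : IsArc π a c) : b = c := by
  rcases lt_trichotomy b c with h | h | h
  · exact absurd hb.2.1 (hc.2.2 b hb.1 h)
  · exact h
  · exact absurd hc.2.1 (hb.2.2 c hc.1 h)

theorem IsArc.left_unique {a b c : Fin n} (hb : IsArc π b a) (hc : IsArc π c a) : b = c := by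
  rcases lt_trichotomy b c with h | h | h
  · exact absurd (hb.2.1.trans hc.2.1.symm) (hb.2.2 c h hc.1)
  · exact h
  · exact absurd (hc.2.1.trans hb.2.1.symm) (hc.2.2 b h hb.1)

theorem card_Ioi_eq_blockMaxes_add_arcs (a : Fin n) :
    #(Ioi a) = #{b ∈ blockMaxes π | a < b} + #{p ∈ arcs π | a < p.1} := by
  classical
  rw [← card_filter_add_card_filter_not (s := Ioi a) (· ∈ blockMaxes π)]
  congr 1
  · congr 1
    ext b
    simp [and_comm]
  · symm
    refine card_bij (fun p _ => p.1) (fun p hp => ?_) (fun p hp q hq h => ?_) fun b hb => ?_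
    · simp only [mem_filter, mem_arcs, mem_Ioi, mem_blockMaxes] at hp ⊢
      exact ⟨hp.2, fun h => h _ hp.1.1 hp.1.2.1⟩
    · simp only [mem_filter, mem_arcs] at hp hq
      exact Prod.ext h (hp.1.right_unique (h ▸ hq.1))
    · simp only [mem_filter, mem_Ioi, mem_blockMaxes, not_forall, not_not] at hb
      obtain ⟨hab, c, hbc, h⟩ := hb
      obtain ⟨d, hd⟩ := exists_isArc_right hbc h
      exact ⟨(b, d), by simp [mem_arcs, hd, hab], rfl⟩

theorem card_Ioi_eq_blockMins_add_arcs (a : Fin n) :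
    #(Ioi a) = #{b ∈ blockMins π | a < b} + #{p ∈ arcs π | a < p.2} := by
  classical
  rw [← card_filter_add_card_filter_not (s := Ioi a) (· ∈ blockMins π)]
  congr 1
  · congr 1
    ext b
    simp [and_comm]
  · symm
    refine card_bij (fun p _ => p.2) (fun p hp => ?_) (fun p hp q hq h => ?_) fun b hb => ?_
    · simp only [mem_filter, mem_arcs, mem_Ioi, mem_blockMins] at hp ⊢
      exact ⟨hp.2, fun h => h _ hp.1.1 hp.1.2.1.symm⟩
    · simp only [mem_filter, mem_arcs] at hp hq
      exact Prod.ext (hp.1.left_unique (h ▸ hq.1)) h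
    · simp only [mem_filter, mem_Ioi, mem_blockMins, not_forall, not_not] at hb
      obtain ⟨hab, c, hbc, h⟩ := hb
      obtain ⟨d, hd⟩ := exists_isArc_left hbc h
      exact ⟨(d, b), by simp [mem_arcs, hd, hab], rfl⟩

/-- The blocks ending after a block maximum `a` either start after `a` or have an arc over `a`. -/
theorem card_blockMaxes_gt {a : Fin n} (ha : a ∈ blockMaxes π) :
    #{b ∈ blockMaxes π | a < b} =
      #{p ∈ arcs π | p.1 < a ∧ a < p.2} + #{b ∈ blockMins π | a < b} := by
  have hsplit : #{p ∈ arcs π | a < p.2} =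
      #{p ∈ arcs π | a < p.1} + #{p ∈ arcs π | p.1 < a ∧ a < p.2} := by
    rw [← card_filter_add_card_filter_not (s := {p ∈ arcs π | a < p.2}) (fun p => a < p.1),
      filter_filter, filter_filter]
    congr 2 <;> refine filter_congr fun p hp => ?_
    · exact ⟨And.right, fun h => ⟨h.trans (mem_arcs.1 hp).1, h⟩⟩
    · constructor
      · rintro ⟨h₂, h₁⟩
        refine ⟨lt_of_le_of_ne (not_lt.1 h₁) fun h => ?_, h₂⟩
        exact mem_blockMaxes.1 ha p.2 h₂ (h ▸ (mem_arcs.1 hp).2.1)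
      · rintro ⟨h₁, h₂⟩
        exact ⟨h₂, h₁.not_gt⟩
  have h₁ := card_Ioi_eq_blockMaxes_add_arcs (π := π) a
  have h₂ := card_Ioi_eq_blockMins_add_arcs (π := π) a
  omega

end Statistics

theorem two_mul_sum_card_filter_gt {α : Type*} [LinearOrder α] (s : Finset α) :
    2 * ∑ a ∈ s, #{b ∈ s | a < b} + #s = #s * #s := by
  have hswap : ∑ a ∈ s, #{b ∈ s | a < b} = ∑ a ∈ s, #{b ∈ s | b < a} :=
    sum_card_bipartiteAbove_eq_sum_card_bipartiteBelow _
  have hsum : ∑ a ∈ s, (#{b ∈ s | a < b} + #{b ∈ s | b < a} + 1) = ∑ _a ∈ s, #s := by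
    refine sum_congr rfl fun a ha => ?_
    have h₁ := card_filter_add_card_filter_not (s := s) (fun b => a < b)
    have h₂ : {b ∈ s | ¬ a < b} = insert a {b ∈ s | b < a} := by
      ext b
      simp only [mem_filter, mem_insert, not_lt, le_iff_eq_or_lt]
      grind
    rw [h₂, card_insert_of_notMem (by simp)] at h₁
    omega
  simp only [sum_add_distrib, sum_const, smul_eq_mul, mul_one] at hsum
  omega

section AppendElement

variable {n : ℕ} (π : Finpartition (univ : Finset (Fin n)))

open Classical in
/-- The set partition of `[n + 1]` obtained from `π` by adding the new largest element, as a
singleton block (`none`) or to the block of `m` (`some m`). -/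
noncomputable def appendElement (o : Option (Fin n)) :
    Finpartition (univ : Finset (Fin (n + 1))) :=
  Finpartition.ofSetoid <| Setoid.ker <|
    Fin.snoc (α := fun _ => Option (Finset (Fin n))) (fun i => some (π.part i)) (o.map π.part)

variable {π} {o : Option (Fin n)} {a b m : Fin n}

@[simp]
theorem sameBlock_appendElement_castSucc :
    sameBlock (appendElement π o) a.castSucc b.castSucc ↔ sameBlock π a b := by
  rw [appendElement, sameBlock_ofSetoid, Setoid.ker_def]
  simp [sameBlock_iff_part_eq]

@[simp]
theorem sameBlock_appendElement_none_castSucc_last :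
    ¬ sameBlock (appendElement π none) a.castSucc (Fin.last n) := by
  simp [appendElement, sameBlock_ofSetoid, Setoid.ker_def]

@[simp]
theorem sameBlock_appendElement_some_castSucc_last :
    sameBlock (appendElement π (some m)) a.castSucc (Fin.last n) ↔ sameBlock π a m := by
  rw [appendElement, sameBlock_ofSetoid, Setoid.ker_def]
  simp [sameBlock_iff_part_eq]

@[simp]
theorem sameBlock_appendElement_none_last_castSucc :
    ¬ sameBlock (appendElement π none) (Fin.last n) a.castSucc :=
  fun h => sameBlock_appendElement_none_castSucc_last h.symm

@[simp]
theorem sameBlock_appendElement_some_last_castSucc :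
    sameBlock (appendElement π (some m)) (Fin.last n) a.castSucc ↔ sameBlock π m a :=
  ⟨fun h => (sameBlock_appendElement_some_castSucc_last.1 h.symm).symm,
    fun h => (sameBlock_appendElement_some_castSucc_last.2 h.symm).symm⟩

theorem appendElement_injective {π σ : Finpartition (univ : Finset (Fin n))}
    {o o' : Option (Fin n)} (h : appendElement π o = appendElement σ o') : π = σ :=
  finpartition_ext_sameBlock fun a b => by
    rw [← sameBlock_appendElement_castSucc (o := o), h, sameBlock_appendElement_castSucc]

theorem appendElement_option_injOn {o' : Option (Fin n)} (ho : o ∈ insertNone (blockMaxes π))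
    (ho' : o' ∈ insertNone (blockMaxes π)) (h : appendElement π o = appendElement π o') :
    o = o' := by
  cases o with
  | none =>
    cases o' with
    | none => rfl
    | some m' =>
      have := sameBlock_appendElement_some_castSucc_last.2 (sameBlock_self (π := π) m')
      rw [← h] at this
      exact absurd this sameBlock_appendElement_none_castSucc_last
  | some m =>
    have hm := sameBlock_appendElement_some_castSucc_last.2 (sameBlock_self (π := π) m)
    rw [h] at hm
    cases o' with
    | none => exact absurd hm sameBlock_appendElement_none_castSucc_last
    | some m' =>
      rw [eq_of_sameBlock_of_mem_blockMaxes (some_mem_insertNone.1 ho)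
        (some_mem_insertNone.1 ho') (sameBlock_appendElement_some_castSucc_last.1 hm)]

theorem exists_appendElement_eq (σ : Finpartition (univ : Finset (Fin (n + 1)))) :
    ∃ π : Finpartition (univ : Finset (Fin n)), ∃ o ∈ insertNone (blockMaxes π),
      appendElement π o = σ := by
  classical
  let s : Setoid (Fin n) :=
    { r := fun a b => sameBlock σ a.castSucc b.castSucc
      iseqv := ⟨fun _ => sameBlock_self _, fun h => h.symm, fun h h' => h.trans h'⟩ }
  have hs (a b : Fin n) :
      sameBlock (Finpartition.ofSetoid s) a b ↔ sameBlock σ a.castSucc b.castSucc :=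
    sameBlock_ofSetoid s
  refine ⟨Finpartition.ofSetoid s, ?_⟩
  by_cases hlast : ∃ i : Fin n, sameBlock σ i.castSucc (Fin.last n)
  · obtain ⟨i, hi⟩ := hlast
    obtain ⟨m, hm, hmax⟩ := exists_max_image
      (univ.filter fun i : Fin n => sameBlock σ i.castSucc (Fin.last n)) id ⟨i, by simpa using hi⟩
    simp only [mem_filter, mem_univ, true_and, id] at hm hmax
    have hlast_iff (a : Fin n) :
        sameBlock σ a.castSucc m.castSucc ↔ sameBlock σ a.castSucc (Fin.last n) :=
      ⟨fun h => h.trans hm, fun h => h.trans hm.symm⟩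
    refine ⟨some m, ?_, finpartition_ext_sameBlock fun a b => ?_⟩
    · rw [some_mem_insertNone, mem_blockMaxes]
      intro b hb h
      exact absurd (hmax b (((hs _ _).1 h).symm.trans hm)) (not_le.2 hb)
    · induction a using Fin.lastCases with
      | last =>
        induction b using Fin.lastCases with
        | last => simp [sameBlock_self]
        | cast b =>
          rw [sameBlock_appendElement_some_last_castSucc, hs]
          exact ⟨fun h => hm.symm.trans h, fun h => hm.trans h⟩
      | cast a =>
        induction b using Fin.lastCases with
        | last => rw [sameBlock_appendElement_some_castSucc_last, hs, hlast_iff]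
        | cast b => rw [sameBlock_appendElement_castSucc, hs]
  · rw [not_exists] at hlast
    refine ⟨none, none_mem_insertNone, finpartition_ext_sameBlock fun a b => ?_⟩
    induction a using Fin.lastCases with
    | last =>
      induction b using Fin.lastCases with
      | last => simp [sameBlock_self]
      | cast b =>
        exact iff_of_false sameBlock_appendElement_none_last_castSucc fun h => hlast b h.symm
    | cast a =>
      induction b using Fin.lastCases with
      | last => exact iff_of_false sameBlock_appendElement_none_castSucc_last (hlast a)
      | cast b => rw [sameBlock_appendElement_castSucc, hs]

theorem sum_finpartition_succ {M : Type*} [AddCommMonoid M]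
    (F : Finpartition (univ : Finset (Fin (n + 1))) → M) :
    ∑ σ, F σ = ∑ π : Finpartition (univ : Finset (Fin n)),
      (F (appendElement π none) + ∑ m ∈ blockMaxes π, F (appendElement π (some m))) := by
  calc
    ∑ σ, F σ = ∑ x ∈ univ.sigma fun π : Finpartition (univ : Finset (Fin n)) =>
        insertNone (blockMaxes π), F (appendElement x.1 x.2) := by
      symm
      refine sum_bij (fun x _ => appendElement x.1 x.2) (fun _ _ => mem_univ _) ?_ ?_
        fun _ _ => rfl
      · rintro ⟨π, o⟩ hx ⟨σ, o'⟩ hy h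
        simp only [mem_sigma, mem_univ, true_and] at hx hy
        obtain rfl := appendElement_injective h
        rw [appendElement_option_injOn hx hy h]
      · intro σ _
        obtain ⟨π, o, ho, h⟩ := exists_appendElement_eq σ
        exact ⟨⟨π, o⟩, by simpa using ho, h⟩
    _ = _ := by
      rw [sum_sigma]
      exact sum_congr rfl fun π _ =>
        sum_insertNone (fun o => F (appendElement π o)) (blockMaxes π)

theorem blockMaxes_appendElement_none :
    blockMaxes (appendElement π none) =
      insert (Fin.last n) ((blockMaxes π).map Fin.castSuccEmb) := by
  ext a
  induction a using Fin.lastCases with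
  | last => simp [mem_blockMaxes, Fin.forall_fin_succ']
  | cast a => simp [mem_blockMaxes, Fin.forall_fin_succ', Fin.castSucc_ne_last]

theorem blockMaxes_appendElement_some (hm : m ∈ blockMaxes π) :
    blockMaxes (appendElement π (some m)) =
      insert (Fin.last n) (((blockMaxes π).erase m).map Fin.castSuccEmb) := by
  ext a
  induction a using Fin.lastCases with
  | last => simp [mem_blockMaxes, Fin.not_lt.2 (Fin.le_last _)]
  | cast a =>
    have : a ∈ blockMaxes π → (¬ sameBlock π a m ↔ a ≠ m) := fun ha =>
      not_congr ⟨eq_of_sameBlock_of_mem_blockMaxes ha hm, fun h => h ▸ sameBlock_self a⟩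
    simp only [mem_blockMaxes] at this
    simp [mem_blockMaxes, Fin.forall_fin_succ', Fin.castSucc_ne_last]
    tauto

theorem blockMins_appendElement_none :
    blockMins (appendElement π none) =
      insert (Fin.last n) ((blockMins π).map Fin.castSuccEmb) := by
  ext a
  induction a using Fin.lastCases with
  | last => simp [mem_blockMins, Fin.forall_fin_succ']
  | cast a =>
    simp [mem_blockMins, Fin.forall_fin_succ', Fin.castSucc_ne_last, Fin.not_lt.2 (Fin.le_last _)]

theorem blockMins_appendElement_some :
    blockMins (appendElement π (some m)) = (blockMins π).map Fin.castSuccEmb := by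
  ext a
  induction a using Fin.lastCases with
  | last =>
    simp only [mem_blockMins, Fin.forall_fin_succ']
    simpa [Fin.castSucc_ne_last] using ⟨m, sameBlock_self m⟩
  | cast a =>
    simp [mem_blockMins, Fin.forall_fin_succ', Fin.not_lt.2 (Fin.le_last _)]

theorem isArc_appendElement_castSucc :
    IsArc (appendElement π o) a.castSucc b.castSucc ↔ IsArc π a b := by
  simp [IsArc, Fin.forall_fin_succ', Fin.not_lt.2 (Fin.le_last _)]

theorem arcs_appendElement_none :
    arcs (appendElement π none) =
      (arcs π).map (Fin.castSuccEmb.prodMap Fin.castSuccEmb) := by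
  ext ⟨a, b⟩
  induction a using Fin.lastCases with
  | last => simp [mem_arcs, IsArc, Fin.not_lt.2 (Fin.le_last _), Fin.castSucc_ne_last]
  | cast a =>
    induction b using Fin.lastCases with
    | last => simp [mem_arcs, IsArc, Fin.castSucc_ne_last]
    | cast b => simp [mem_arcs, isArc_appendElement_castSucc]

theorem arcs_appendElement_some (hm : m ∈ blockMaxes π) :
    arcs (appendElement π (some m)) = insert (m.castSucc, Fin.last n)
      ((arcs π).map (Fin.castSuccEmb.prodMap Fin.castSuccEmb)) := by
  ext ⟨a, b⟩
  induction a using Fin.lastCases with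
  | last =>
    simp [mem_arcs, IsArc, Fin.not_lt.2 (Fin.le_last _), Fin.castSucc_ne_last,
      (Fin.castSucc_ne_last _).symm]
  | cast a =>
    induction b using Fin.lastCases with
    | last =>
      simp only [mem_arcs, IsArc, Fin.forall_fin_succ']
      simp [Fin.castSucc_ne_last]
      constructor
      · rintro ⟨h, h'⟩
        rcases lt_trichotomy a m with ham | ham | ham
        · exact absurd h (h' m ham)
        · exact ham
        · exact absurd h.symm (mem_blockMaxes.1 hm a ham)
      · rintro rfl
        exact ⟨sameBlock_self a, mem_blockMaxes.1 hm⟩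
    | cast b => simp [mem_arcs, isArc_appendElement_castSucc, (Fin.castSucc_ne_last _)]

theorem card_parts_appendElement_none : #(appendElement π none).parts = #π.parts + 1 := by
  rw [card_parts_eq_card_blockMaxes, card_parts_eq_card_blockMaxes,
    blockMaxes_appendElement_none, card_insert_of_notMem (by simp [Fin.castSucc_ne_last]), card_map]

theorem card_parts_appendElement_some (hm : m ∈ blockMaxes π) :
    #(appendElement π (some m)).parts = #π.parts := by
  rw [card_parts_eq_card_blockMaxes, card_parts_eq_card_blockMaxes,
    blockMaxes_appendElement_some hm, card_insert_of_notMem (by simp [Fin.castSucc_ne_last]),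
    card_map, card_erase_add_one hm]

theorem crl_appendElement_none : crl (appendElement π none) = crl π := by
  simp [crl_eq_sum_arcs, arcs_appendElement_none, filter_map, Function.comp_def]

theorem crl_appendElement_some (hm : m ∈ blockMaxes π) :
    crl (appendElement π (some m)) = crl π + #{p ∈ arcs π | p.1 < m ∧ m < p.2} := by
  rw [crl_eq_sum_arcs, crl_eq_sum_arcs, arcs_appendElement_some hm,
    sum_insert (by simp [Fin.castSucc_ne_last]), add_comm]
  simp [filter_insert, filter_map, Function.comp_def, Fin.not_lt.2 (Fin.le_last _),
    Fin.castSucc_lt_last]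

theorem separatedPairs_appendElement_none :
    separatedPairs (appendElement π none) = separatedPairs π + #π.parts := by
  rw [separatedPairs, separatedPairs, blockMaxes_appendElement_none, blockMins_appendElement_none,
    sum_insert (by simp [Fin.castSucc_ne_last]), card_parts_eq_card_blockMaxes]
  simp [filter_insert, filter_map, Function.comp_def, Fin.not_lt.2 (Fin.le_last _),
    Fin.castSucc_lt_last, Fin.castSucc_ne_last, sum_add_distrib]

theorem separatedPairs_appendElement_some (hm : m ∈ blockMaxes π) :
    separatedPairs (appendElement π (some m)) + #{b ∈ blockMins π | m < b} =
      separatedPairs π := by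
  rw [separatedPairs, separatedPairs, blockMaxes_appendElement_some hm,
    blockMins_appendElement_some, sum_insert (by simp [Fin.castSucc_ne_last]),
    ← sum_erase_add _ _ hm]
  simp [filter_map, Function.comp_def, Fin.not_lt.2 (Fin.le_last _), -map_erase]

end AppendElement

section Recurrences

theorem mem_Pik {n k : ℕ} {π : Finpartition (univ : Finset (Fin n))} :
    π ∈ Pik n k ↔ #π.parts = k := by
  simp [Pik]

theorem stirling_eq_card_Pik (n k : ℕ) : stirling n k = #(Pik n k) := by
  rw [stirling, Nat.card_eq_fintype_card, Fintype.card_subtype, Pik]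

theorem sum_Pik_succ_succ (n k : ℕ) (F : Finpartition (univ : Finset (Fin (n + 1))) → ℝ) :
    ∑ σ ∈ Pik (n + 1) (k + 1), F σ = ∑ π ∈ Pik n k, F (appendElement π none) +
      ∑ π ∈ Pik n (k + 1), ∑ m ∈ blockMaxes π, F (appendElement π (some m)) := by
  simp only [Pik, sum_filter]
  rw [sum_finpartition_succ, sum_add_distrib]
  congr 1
  · simp [card_parts_appendElement_none]
  · refine sum_congr rfl fun π _ => ?_
    rw [sum_congr rfl fun m hm => by rw [card_parts_appendElement_some hm]]
    split_ifs <;> simp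

theorem Pik_succ_zero (n : ℕ) : Pik (n + 1) 0 = ∅ := by
  refine eq_empty_of_forall_notMem fun π hπ => ?_
  rw [mem_Pik, card_eq_zero, π.parts_eq_empty_iff] at hπ
  exact univ_nonempty.ne_empty hπ

theorem Pik_zero_succ (k : ℕ) : Pik 0 (k + 1) = ∅ := by
  refine eq_empty_of_forall_notMem fun π hπ => ?_
  have := π.card_parts_le_card
  simp [mem_Pik.1 hπ] at this

theorem stirling_succ_zero (n : ℕ) : stirling (n + 1) 0 = 0 := by
  rw [stirling_eq_card_Pik, Pik_succ_zero, card_empty]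

theorem stirling_zero_succ (k : ℕ) : stirling 0 (k + 1) = 0 := by
  rw [stirling_eq_card_Pik, Pik_zero_succ, card_empty]

theorem sum_blockMaxes_const {n k : ℕ} {π : Finpartition (univ : Finset (Fin n))}
    (hπ : π ∈ Pik n k) (c : ℝ) : ∑ _m ∈ blockMaxes π, c = k * c := by
  rw [sum_const, ← card_parts_eq_card_blockMaxes, mem_Pik.1 hπ, nsmul_eq_mul]

theorem stirling_succ_succ (n k : ℕ) :
    stirling (n + 1) (k + 1) = stirling n k + (k + 1) * stirling n (k + 1) := by
  have h := sum_Pik_succ_succ n k fun _ => 1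
  rw [sum_congr rfl fun π hπ => sum_blockMaxes_const hπ 1] at h
  simp only [sum_const, nsmul_eq_mul, mul_one, ← stirling_eq_card_Pik] at h
  rw [mul_comm (k + 1)]
  exact_mod_cast h

theorem stirling_pos {n k : ℕ} (hk : 1 ≤ k) (hkn : k ≤ n) : 0 < stirling n k := by
  induction n generalizing k with
  | zero => omega
  | succ n ih =>
    obtain ⟨k, rfl⟩ := Nat.exists_eq_add_of_le' hk
    rw [stirling_succ_succ]
    rcases (Nat.le_of_succ_le_succ hkn).eq_or_lt with rfl | h
    · rcases k with _ | k
      · have : 0 < stirling 0 0 := by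
          rw [stirling_eq_card_Pik]
          exact card_pos.2 ⟨⊥, mem_Pik.2 (by simp)⟩
        omega
      · have := ih (k := k + 1) (by omega) le_rfl
        omega
    · have := ih (k := k + 1) (by omega) h
      positivity

theorem sum_separatedPairs_appendElement_some {n k : ℕ}
    {π : Finpartition (univ : Finset (Fin n))} (hπ : π ∈ Pik n (k + 1)) :
    ∑ m ∈ blockMaxes π, (separatedPairs (appendElement π (some m)) : ℝ) =
      k * separatedPairs π := by
  have h : ∑ m ∈ blockMaxes π, (separatedPairs (appendElement π (some m)) : ℝ) +
      separatedPairs π = ∑ _m ∈ blockMaxes π, (separatedPairs π : ℝ) := by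
    conv_lhs => enter [2]; rw [separatedPairs]
    rw [Nat.cast_sum, ← sum_add_distrib]
    exact sum_congr rfl fun m hm => mod_cast separatedPairs_appendElement_some hm
  rw [sum_blockMaxes_const hπ] at h
  push_cast at h
  linarith

theorem sum_crl_appendElement_some {n k : ℕ}
    {π : Finpartition (univ : Finset (Fin n))} (hπ : π ∈ Pik n (k + 1)) :
    ∑ m ∈ blockMaxes π, (crl (appendElement π (some m)) : ℝ) =
      (k + 1) * crl π + (k * (k + 1) / 2 - separatedPairs π) := by
  have hpairs := two_mul_sum_card_filter_gt (blockMaxes π)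
  rw [sum_congr rfl fun m hm => card_blockMaxes_gt hm, sum_add_distrib, ← separatedPairs,
    ← card_parts_eq_card_blockMaxes, mem_Pik.1 hπ] at hpairs
  rw [sum_congr rfl fun m hm => by rw [crl_appendElement_some hm]]
  push_cast
  rw [sum_add_distrib, sum_blockMaxes_const hπ]
  have := congrArg (Nat.cast (R := ℝ)) hpairs
  push_cast at this ⊢
  linarith

theorem sum_separatedPairs_succ_succ (n k : ℕ) :
    ∑ σ ∈ Pik (n + 1) (k + 1), (separatedPairs σ : ℝ) =
      ∑ π ∈ Pik n k, (separatedPairs π : ℝ) + k * stirling n k +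
        k * ∑ π ∈ Pik n (k + 1), (separatedPairs π : ℝ) := by
  rw [sum_Pik_succ_succ, sum_congr rfl fun π hπ => sum_separatedPairs_appendElement_some hπ,
    ← mul_sum]
  congr 1
  rw [sum_congr rfl fun π hπ => by
    rw [separatedPairs_appendElement_none, mem_Pik.1 hπ, Nat.cast_add], sum_add_distrib,
    sum_const, nsmul_eq_mul, stirling_eq_card_Pik, mul_comm (k : ℝ)]

theorem sum_crl_succ_succ (n k : ℕ) :
    ∑ σ ∈ Pik (n + 1) (k + 1), (crl σ : ℝ) =
      ∑ π ∈ Pik n k, (crl π : ℝ) + (k + 1) * ∑ π ∈ Pik n (k + 1), (crl π : ℝ) +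
        (k * (k + 1) / 2 * stirling n (k + 1) -
          ∑ π ∈ Pik n (k + 1), (separatedPairs π : ℝ)) := by
  rw [sum_Pik_succ_succ, sum_congr rfl fun π hπ => sum_crl_appendElement_some hπ]
  simp only [crl_appendElement_none, sum_add_distrib, sum_sub_distrib, ← mul_sum, sum_const,
    nsmul_eq_mul, stirling_eq_card_Pik]
  ring

theorem sum_separatedPairs_Pik_zero (n : ℕ) : ∑ π ∈ Pik n 0, (separatedPairs π : ℝ) = 0 := by
  cases n with
  | zero => exact sum_eq_zero fun π _ => by simp [separatedPairs, eq_empty_of_isEmpty]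
  | succ n => rw [Pik_succ_zero, sum_empty]

theorem sum_crl_Pik_zero (n : ℕ) : ∑ π ∈ Pik n 0, (crl π : ℝ) = 0 := by
  cases n with
  | zero => exact sum_eq_zero fun π _ => by simp [crl_eq_sum_arcs, eq_empty_of_isEmpty]
  | succ n => rw [Pik_succ_zero, sum_empty]

theorem sum_separatedPairs (n k : ℕ) :
    ∑ π ∈ Pik n (k + 1), (separatedPairs π : ℝ) = (n - k) * stirling n k := by
  induction n generalizing k with
  | zero =>
    rw [Pik_zero_succ, sum_empty]
    rcases k with _ | k <;> simp [stirling_zero_succ]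
  | succ n ih =>
    rw [sum_separatedPairs_succ_succ, ih]
    rcases k with _ | k
    · simp [sum_separatedPairs_Pik_zero, stirling_succ_zero]
    · rw [ih, stirling_succ_succ]
      push_cast
      ring

theorem sum_crl (n k : ℕ) :
    ∑ π ∈ Pik n (k + 1), (crl π : ℝ) =
      (n * k / 2 - 5 / 4 * k * (k + 1)) * stirling n (k + 1) +
        3 / 2 * (n - k) * stirling n k := by
  induction n generalizing k with
  | zero =>
    rw [Pik_zero_succ, sum_empty]
    rcases k with _ | k <;> simp [stirling_zero_succ]
  | succ n ih =>
    rw [sum_crl_succ_succ, ih, sum_separatedPairs]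
    rcases k with _ | k
    · rcases n with _ | n <;> simp [sum_crl_Pik_zero, stirling_succ_zero]
    · rw [ih, stirling_succ_succ, stirling_succ_succ]
      push_cast
      ring

end Recurrences

/-- Theorem (Kasraoui): exact formula for the mean of the linear crossing number on `Π_n^k`. -/
theorem mean_crl_blocks (n k : ℕ) (hk : 1 ≤ k) (hkn : k ≤ n) :
    EX n k = (1 / 2 : ℝ) * (n : ℝ) * ((k : ℝ) - 1) - (5 / 4 : ℝ) * (k : ℝ) * ((k : ℝ) - 1)
        + (3 / 2 : ℝ) * ((n : ℝ) + 1 - (k : ℝ)) *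
          ((stirling n (k - 1) : ℝ) / (stirling n k : ℝ)) ∧
    (∑ π ∈ Pik n k, (crl π : ℝ)) =
      (1 / 2 : ℝ) * (n : ℝ) * ((k : ℝ) - 1) * (stirling n k : ℝ)
        - (5 / 4 : ℝ) * (k : ℝ) * ((k : ℝ) - 1) * (stirling n k : ℝ)
        + (3 / 2 : ℝ) * ((n : ℝ) + 1 - (k : ℝ)) * (stirling n (k - 1) : ℝ) := by
  have hsum : (∑ π ∈ Pik n k, (crl π : ℝ)) =
      (1 / 2 : ℝ) * (n : ℝ) * ((k : ℝ) - 1) * (stirling n k : ℝ)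
        - (5 / 4 : ℝ) * (k : ℝ) * ((k : ℝ) - 1) * (stirling n k : ℝ)
        + (3 / 2 : ℝ) * ((n : ℝ) + 1 - (k : ℝ)) * (stirling n (k - 1) : ℝ) := by
    obtain ⟨j, rfl⟩ := Nat.exists_eq_add_of_le' hk
    rw [sum_crl, Nat.add_sub_cancel]
    push_cast
    ring
  refine ⟨?_, hsum⟩
  have hpos : (stirling n k : ℝ) ≠ 0 := Nat.cast_ne_zero.2 (stirling_pos hk hkn).ne'
  rw [EX, hsum]
  field_simp
end

section
/- Let (k_n)_{n≥2} be any sequence of positive integers with k_n/√n → 0 as n → ∞. Then Var(Y_{n,k_n}) = (k_n²−1)·n/12 + O(k_n³·√n), i.e. there is a constant C > 0 such that |Var(Y_{n,k_n}) − (k_n²−1)·n/12| ≤ C·k_n³·√n for all n ≥ 2. -/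
open Finset

open Classical in
/-- The set partition of `[n]` into the fibres of the word `w`. -/
noncomputable def fiberPartition {n k : ℕ} (w : Fin n → Fin k) : Finpartition (univ : Finset (Fin n)) :=
  Finpartition.ofSetoid (Setoid.ker w)

theorem mem_part_fiberPartition {n k : ℕ} {w : Fin n → Fin k} {a b : Fin n} :
    b ∈ (fiberPartition w).part a ↔ w a = w b := by
  classical exact Finpartition.mem_part_ofSetoid_iff_rel

theorem mem_parts_fiberPartition {n k : ℕ} {w : Fin n → Fin k} {B : Finset (Fin n)} {a : Fin n}
    (ha : a ∈ B) : B ∈ (fiberPartition w).parts ↔ ∀ c, c ∈ B ↔ w a = w c := by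
  constructor
  · intro hB c
    rw [← Finpartition.part_eq_of_mem _ hB ha, mem_part_fiberPartition]
  · intro h
    have : B = (fiberPartition w).part a := by
      ext c
      rw [h, mem_part_fiberPartition]
    rw [this, Finpartition.part_mem]
    exact mem_univ a

/-- The word recording, for each element of `[n]`, the label of its block. -/
def labelWord {n k : ℕ} (π : Finpartition (univ : Finset (Fin n))) (e : π.parts ≃ Fin k) :
    Fin n → Fin k :=
  fun i => e ⟨π.part i, π.part_mem.2 (mem_univ i)⟩

theorem labelWord_eq_iff {n k : ℕ} (π : Finpartition (univ : Finset (Fin n)))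
    (e : π.parts ≃ Fin k) {a b : Fin n} :
    labelWord π e a = labelWord π e b ↔ π.part a = π.part b := by
  simp [labelWord]

theorem labelWord_surjective {n k : ℕ} (π : Finpartition (univ : Finset (Fin n)))
    (e : π.parts ≃ Fin k) : Function.Surjective (labelWord π e) := by
  intro c
  obtain ⟨a, ha⟩ := π.nonempty_of_mem_parts (e.symm c).2
  refine ⟨a, ?_⟩
  rw [labelWord, ← Equiv.eq_symm_apply]
  exact Subtype.ext (π.part_eq_of_mem (e.symm c).2 ha)

theorem finpartition_ext_part {n : ℕ} {π ρ : Finpartition (univ : Finset (Fin n))}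
    (h : ∀ a, π.part a = ρ.part a) : π = ρ := by
  have aux : ∀ {π ρ : Finpartition (univ : Finset (Fin n))}, (∀ a, π.part a = ρ.part a) →
      π.parts ⊆ ρ.parts := by
    intro π ρ h B hB
    obtain ⟨a, ha⟩ := π.nonempty_of_mem_parts hB
    rw [← π.part_eq_of_mem hB ha, h]
    exact ρ.part_mem.2 (mem_univ a)
  exact Finpartition.ext (Subset.antisymm (aux h) (aux fun a => (h a).symm))

theorem fiberPartition_labelWord {n k : ℕ} (π : Finpartition (univ : Finset (Fin n)))
    (e : π.parts ≃ Fin k) : fiberPartition (labelWord π e) = π := by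
  refine finpartition_ext_part fun a => ?_
  ext b
  rw [mem_part_fiberPartition, labelWord_eq_iff, eq_comm,
    π.mem_part_iff_part_eq_part (mem_univ b) (mem_univ a)]

theorem labelWord_injective {n k : ℕ} (π : Finpartition (univ : Finset (Fin n))) :
    Function.Injective (labelWord π : (π.parts ≃ Fin k) → Fin n → Fin k) := by
  intro e e' h
  ext ⟨B, hB⟩
  obtain ⟨a, ha⟩ := π.nonempty_of_mem_parts hB
  have := congrFun h a
  simp only [labelWord, π.part_eq_of_mem hB ha] at this
  rw [this]

theorem exists_labelWord_eq {n k : ℕ} {w : Fin n → Fin k} (hw : Function.Surjective w) :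
    ∃ e : (fiberPartition w).parts ≃ Fin k, labelWord (fiberPartition w) e = w := by
  let f : Fin k → (fiberPartition w).parts := fun c =>
    ⟨(fiberPartition w).part (hw c).choose, (fiberPartition w).part_mem.2 (mem_univ _)⟩
  have hf : ∀ a, f (w a) = ⟨(fiberPartition w).part a,
      (fiberPartition w).part_mem.2 (mem_univ _)⟩ := by
    intro a
    refine Subtype.ext ?_
    rw [← Finpartition.mem_part_iff_part_eq_part _ (mem_univ _) (mem_univ _),
      mem_part_fiberPartition]
    exact (hw (w a)).choose_spec.symm
  have hbij : Function.Bijective f := by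
    constructor
    · intro c c' h
      have h := congrArg Subtype.val h
      rw [← Finpartition.mem_part_iff_part_eq_part _ (mem_univ _) (mem_univ _),
        mem_part_fiberPartition, (hw c).choose_spec, (hw c').choose_spec] at h
      exact h.symm
    · rintro ⟨B, hB⟩
      obtain ⟨a, ha⟩ := Finpartition.nonempty_of_mem_parts _ hB
      refine ⟨w a, ?_⟩
      rw [hf]
      exact Subtype.ext (Finpartition.part_eq_of_mem _ hB ha)
  refine ⟨(Equiv.ofBijective f hbij).symm, funext fun a => ?_⟩
  rw [labelWord, Equiv.symm_apply_eq, Equiv.ofBijective_apply, hf]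

/-- The words of length `n` using every letter of `Fin k`. -/
def surjWords (n k : ℕ) : Finset (Fin n → Fin k) :=
  univ.filter fun w => Function.Surjective w

theorem fiberPartition_mem_Pik {n k : ℕ} {w : Fin n → Fin k} (hw : w ∈ surjWords n k) :
    fiberPartition w ∈ Pik n k := by
  obtain ⟨e, -⟩ := exists_labelWord_eq (mem_filter.1 hw).2
  simpa [Pik] using Fintype.card_congr e

theorem card_fiber_fiberPartition {n k : ℕ} {π : Finpartition (univ : Finset (Fin n))}
    (hπ : π ∈ Pik n k) :
    #{w ∈ surjWords n k | fiberPartition w = π} = k.factorial := by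
  have hk : Fintype.card π.parts = k := by simpa [Pik] using hπ
  have hcard : #(univ : Finset (π.parts ≃ Fin k)) = k.factorial := by
    rw [card_univ, Fintype.card_equiv (Fintype.equivFinOfCardEq hk), hk]
  rw [← hcard]
  symm
  refine card_bij (fun e _ => labelWord π e) ?_ ?_ ?_
  · intro e _
    simp [surjWords, labelWord_surjective, fiberPartition_labelWord]
  · intro e _ e' _ h
    exact labelWord_injective π h
  · intro w hw
    obtain ⟨hmem, rfl⟩ := mem_filter.1 hw
    obtain ⟨e, he⟩ := exists_labelWord_eq (mem_filter.1 hmem).2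
    exact ⟨e, mem_univ e, he⟩

theorem sum_surjWords {n k : ℕ} (F : Finpartition (univ : Finset (Fin n)) → ℝ) :
    ∑ w ∈ surjWords n k, F (fiberPartition w) = k.factorial * ∑ π ∈ Pik n k, F π := by
  rw [← sum_fiberwise_of_maps_to (fun w hw => fiberPartition_mem_Pik hw), mul_sum]
  refine sum_congr rfl fun π hπ => ?_
  rw [sum_congr rfl fun w hw => by rw [(mem_filter.1 hw).2], sum_const,
    card_fiber_fiberPartition hπ, nsmul_eq_mul]

theorem card_surjWords (n k : ℕ) : #(surjWords n k) = k.factorial * stirling n k := by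
  have h := sum_surjWords (n := n) (k := k) fun _ => 1
  have hs : stirling n k = #(Pik n k) := by
    rw [stirling, Nat.card_eq_fintype_card, Fintype.card_subtype, Pik]
  simp only [sum_const, nsmul_eq_mul, mul_one] at h
  rw [hs]
  exact_mod_cast h

/-- The variance over set partitions equals the variance over surjective words. -/
theorem VarY_eq_surjWords (n k : ℕ) :
    VarY n k = (∑ w ∈ surjWords n k, (crc (fiberPartition w) : ℝ) ^ 2) / #(surjWords n k) -
      ((∑ w ∈ surjWords n k, (crc (fiberPartition w) : ℝ)) / #(surjWords n k)) ^ 2 := by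
  have hk : (k.factorial : ℝ) ≠ 0 := by exact_mod_cast k.factorial_ne_zero
  rw [sum_surjWords fun π => (crc π : ℝ) ^ 2, sum_surjWords fun π => (crc π : ℝ), card_surjWords]
  push_cast
  rw [mul_div_mul_left _ _ hk, mul_div_mul_left _ _ hk]
  rfl

/-- `(a, b)` joins consecutive occurrences of a letter in the word `w`. -/
def IsWordArc {n k : ℕ} (w : Fin n → Fin k) (a b : Fin n) : Prop :=
  a < b ∧ w a = w b ∧ ∀ c, w a = w c → ¬(a < c ∧ c < b)

/-- `(a, b)` joins the first and last occurrence of a letter in the word `w`. -/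
def IsWordSpan {n k : ℕ} (w : Fin n → Fin k) (a b : Fin n) : Prop :=
  w a = w b ∧ ∀ c, w a = w c → a ≤ c ∧ c ≤ b

theorem IsWordArc.isChord {n k : ℕ} {w : Fin n → Fin k} {a b : Fin n} (h : IsWordArc w a b) :
    IsChord (fiberPartition w) a b := by
  refine ⟨h.1, (fiberPartition w).part a, Finpartition.part_mem _ |>.2 (mem_univ a),
    mem_part_fiberPartition.2 rfl, mem_part_fiberPartition.2 h.2.1, Or.inl fun c hc => ?_⟩
  exact h.2.2 c (mem_part_fiberPartition.1 hc)

theorem isWordArc_or_isWordSpan {n k : ℕ} {w : Fin n → Fin k} {a b : Fin n}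
    (h : IsChord (fiberPartition w) a b) : IsWordArc w a b ∨ IsWordSpan w a b := by
  obtain ⟨hab, B, hB, ha, hb, h⟩ := h
  have hmem := (mem_parts_fiberPartition ha).1 hB
  simp only [hmem] at h
  exact h.imp (fun h => ⟨hab, (hmem b).1 hb, h⟩) fun h => ⟨(hmem b).1 hb, h.2⟩

theorem IsWordArc.eq_of_overlap {n k : ℕ} {w : Fin n → Fin k} {a b a' b' : Fin n}
    (h : IsWordArc w a b) (h' : IsWordArc w a' b') (hw : w a = w a') (h₁ : a < b')
    (h₂ : a' < b) : a = a' ∧ b = b' := by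
  have ha : ¬ a < a' := fun hlt => h.2.2 a' hw ⟨hlt, h₂⟩
  have ha' : ¬ a' < a := fun hlt => h'.2.2 a hw.symm ⟨hlt, h₁⟩
  obtain rfl : a = a' := le_antisymm (not_lt.1 ha') (not_lt.1 ha)
  have hb : ¬ b < b' := fun hlt => h'.2.2 b h.2.1 ⟨h₂, hlt⟩
  have hb' : ¬ b' < b := fun hlt => h.2.2 b' h'.2.1 ⟨h₁, hlt⟩
  exact ⟨rfl, le_antisymm (not_lt.1 hb') (not_lt.1 hb)⟩

theorem IsWordSpan.eq_of_letter_eq {n k : ℕ} {w : Fin n → Fin k} {a b a' b' : Fin n}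
    (h : IsWordSpan w a b) (h' : IsWordSpan w a' b') (hw : w a = w a') : a = a' ∧ b = b' := by
  have h₁ := h.2 a' hw
  have h₂ := h'.2 a hw.symm
  have h₃ := h.2 b' (hw.trans h'.1)
  have h₄ := h'.2 b (hw.symm.trans h.1)
  exact ⟨le_antisymm h₁.1 h₂.1, le_antisymm h₄.2 h₃.2⟩

/-- The word `w` followed by all letters in cyclic order. -/
def extendWord {n k : ℕ} [NeZero k] (w : Fin n → Fin k) (i : ℕ) : Fin k :=
  if h : i < n then w ⟨i, h⟩ else Fin.ofNat k (i - n)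

theorem extendWord_surjective {n k : ℕ} [NeZero k] (w : Fin n → Fin k) :
    Function.Surjective (extendWord w) := by
  intro c
  refine ⟨n + c, ?_⟩
  simp [extendWord]

open Classical in
/-- The letters that occur in the sequence `v` before the first occurrence of `c`. -/
noncomputable def lettersBefore {k : ℕ} (v : ℕ → Fin k) (c : Fin k) : Finset (Fin k) :=
  univ.filter fun d => ∃ j, v j = d ∧ ∀ i ≤ j, v i ≠ c

theorem mem_lettersBefore {k : ℕ} {v : ℕ → Fin k} {c d : Fin k} :
    d ∈ lettersBefore v c ↔ ∃ j, v j = d ∧ ∀ i ≤ j, v i ≠ c := by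
  simp [lettersBefore]

/-- The letters seen after position `t` of `w` before the letter at `t` recurs in the
extended word. -/
noncomputable def gapLetters {n k : ℕ} [NeZero k] (w : Fin n → Fin k) (t : Fin n) :
    Finset (Fin k) :=
  lettersBefore (fun i => extendWord w (t + 1 + i)) (w t)

/-- The sum over all positions `t` of `w` of the number of letters separating `t` from the next
occurrence of its letter. -/
noncomputable def totalRank {n k : ℕ} [NeZero k] (w : Fin n → Fin k) : ℕ :=
  ∑ t, #(gapLetters w t)

theorem mem_gapLetters_of_word {n k : ℕ} [NeZero k] {w : Fin n → Fin k} {t j : Fin n}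
    (htj : t < j) (h : ∀ i, t < i → i ≤ j → w i ≠ w t) : w j ∈ gapLetters w t := by
  have htj' : (t : ℕ) < j := htj
  refine mem_lettersBefore.2 ⟨j - t - 1, ?_, fun i hi => ?_⟩
  · have : (t : ℕ) + 1 + (j - t - 1) = j := by omega
    simp [this, extendWord]
  · have hin : (t : ℕ) + 1 + i < n := by have := j.2; omega
    simp only [extendWord, hin, dif_pos]
    exact h _ (Fin.lt_def.2 (by simp only; omega)) (Fin.le_def.2 (by simp only; omega))

theorem exists_of_mem_gapLetters {n k : ℕ} [NeZero k] {w : Fin n → Fin k} {t s : Fin n}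
    {d : Fin k} (hts : t < s) (hs : w s = w t) (hd : d ∈ gapLetters w t) :
    ∃ j, t < j ∧ w j = d ∧ ∀ i, t < i → i ≤ j → w i ≠ w t := by
  have hts' : (t : ℕ) < s := hts
  obtain ⟨j, hj, h⟩ := mem_lettersBefore.1 hd
  have hjs : ¬ (s : ℕ) - t - 1 ≤ j := by
    intro hle
    have : (t : ℕ) + 1 + (s - t - 1) = s := by omega
    exact h _ hle (by simp [this, extendWord, hs])
  have hjn : (t : ℕ) + 1 + j < n := by have := s.2; omega
  refine ⟨⟨t + 1 + j, hjn⟩, Fin.lt_def.2 (by simp only; omega), ?_, fun i hti hij => ?_⟩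
  · simpa [extendWord, hjn] using hj
  · have hti' : (t : ℕ) < i := hti
    have hij' : (i : ℕ) ≤ t + 1 + j := hij
    have := h (i - t - 1) (by omega)
    have hi : (t : ℕ) + 1 + (i - t - 1) = i := by omega
    simpa [extendWord, hi] using this

/-- The pairs counted by `totalRank`. -/
noncomputable def rankPairs {n k : ℕ} [NeZero k] (w : Fin n → Fin k) : Finset (Fin n × Fin k) :=
  univ.filter fun p => p.2 ∈ gapLetters w p.1

theorem card_rankPairs {n k : ℕ} [NeZero k] (w : Fin n → Fin k) :
    #(rankPairs w) = totalRank w := by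
  rw [rankPairs, card_filter, Fintype.sum_prod_type, totalRank]
  exact sum_congr rfl fun t _ => by simp

open Classical in
/-- The pairs of crossing chords counted by `crc (fiberPartition w)`. -/
noncomputable def chordCrossings {n k : ℕ} (w : Fin n → Fin k) :
    Finset ((Fin n × Fin n) × (Fin n × Fin n)) :=
  univ.filter fun q => IsChord (fiberPartition w) q.1.1 q.1.2 ∧
    IsChord (fiberPartition w) q.2.1 q.2.2 ∧ q.1.1 < q.2.1 ∧ q.2.1 < q.1.2 ∧ q.1.2 < q.2.2

theorem card_chordCrossings {n k : ℕ} (w : Fin n → Fin k) :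
    #(chordCrossings w) = crc (fiberPartition w) := by
  rw [crc, ← Set.ncard_coe_finset]
  simp [chordCrossings]

theorem card_le_sq_of_injOn {α : Type*} {k : ℕ} {s : Finset α} (f : α → Fin k × Fin k)
    (hf : Set.InjOn f s) : #s ≤ k ^ 2 := by
  have := card_le_card_of_injOn f (fun _ _ => mem_univ _) hf
  simpa [sq] using this

theorem crc_le_totalRank {n k : ℕ} [NeZero k] (w : Fin n → Fin k) :
    crc (fiberPartition w) ≤ totalRank w + 3 * k ^ 2 := by
  classical
  let Q (P R : Fin n → Fin n → Prop) : Finset ((Fin n × Fin n) × (Fin n × Fin n)) :=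
    univ.filter fun q => P q.1.1 q.1.2 ∧ R q.2.1 q.2.2 ∧
      q.1.1 < q.2.1 ∧ q.2.1 < q.1.2 ∧ q.1.2 < q.2.2
  have hsub : chordCrossings w ⊆ Q (IsWordArc w) (IsWordArc w) ∪
      (Q (IsWordArc w) (IsWordSpan w) ∪ (Q (IsWordSpan w) (IsWordArc w) ∪
        Q (IsWordSpan w) (IsWordSpan w))) := by
    intro q hq
    obtain ⟨h₁, h₂, hlt⟩ := (mem_filter.1 hq).2
    have h₁ := isWordArc_or_isWordSpan h₁
    have h₂ := isWordArc_or_isWordSpan h₂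
    simp only [mem_union, Q, mem_filter, mem_univ, true_and]
    tauto
  have hAA : #(Q (IsWordArc w) (IsWordArc w)) ≤ totalRank w := by
    rw [← card_rankPairs]
    refine card_le_card_of_injOn (fun q => (q.2.1, w q.1.1)) ?_ ?_
    · rintro ⟨⟨a, b⟩, ⟨c, d⟩⟩ hq
      obtain ⟨h₁, h₂, hac, hcb, hbd⟩ := (mem_filter.1 hq).2
      have := mem_gapLetters_of_word (w := w) hcb fun i hci hib he =>
        h₂.2.2 i he.symm ⟨hci, hib.trans_lt hbd⟩
      simpa [rankPairs, h₁.2.1] using this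
    · rintro ⟨⟨a, b⟩, ⟨c, d⟩⟩ hq ⟨⟨a', b'⟩, ⟨c', d'⟩⟩ hq' he
      obtain ⟨h₁, h₂, hac, hcb, hbd⟩ := (mem_filter.1 hq).2
      obtain ⟨h₁', h₂', hac', hcb', hbd'⟩ := (mem_filter.1 hq').2
      obtain ⟨rfl, hw⟩ := Prod.mk.inj he
      dsimp only at *
      obtain ⟨rfl, rfl⟩ := h₁.eq_of_overlap h₁' hw (hac.trans hcb') (hac'.trans hcb)
      obtain ⟨-, rfl⟩ := h₂.eq_of_overlap h₂' rfl h₂'.1 h₂.1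
      rfl
  have hAS : #(Q (IsWordArc w) (IsWordSpan w)) ≤ k ^ 2 := by
    refine card_le_sq_of_injOn (fun q => (w q.2.1, w q.1.1)) ?_
    rintro ⟨⟨a, b⟩, ⟨c, d⟩⟩ hq ⟨⟨a', b'⟩, ⟨c', d'⟩⟩ hq' he
    obtain ⟨h₁, h₂, hac, hcb, hbd⟩ := (mem_filter.1 hq).2
    obtain ⟨h₁', h₂', hac', hcb', hbd'⟩ := (mem_filter.1 hq').2
    obtain ⟨hw₂, hw⟩ := Prod.mk.inj he
    dsimp only at *
    obtain ⟨rfl, rfl⟩ := h₂.eq_of_letter_eq h₂' hw₂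
    obtain ⟨rfl, rfl⟩ := h₁.eq_of_overlap h₁' hw (hac.trans hcb') (hac'.trans hcb)
    rfl
  have hSA : #(Q (IsWordSpan w) (IsWordArc w)) ≤ k ^ 2 := by
    refine card_le_sq_of_injOn (fun q => (w q.2.1, w q.1.1)) ?_
    rintro ⟨⟨a, b⟩, ⟨c, d⟩⟩ hq ⟨⟨a', b'⟩, ⟨c', d'⟩⟩ hq' he
    obtain ⟨h₁, h₂, hac, hcb, hbd⟩ := (mem_filter.1 hq).2
    obtain ⟨h₁', h₂', hac', hcb', hbd'⟩ := (mem_filter.1 hq').2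
    obtain ⟨hw₂, hw⟩ := Prod.mk.inj he
    dsimp only at *
    obtain ⟨rfl, rfl⟩ := h₁.eq_of_letter_eq h₁' hw
    obtain ⟨rfl, rfl⟩ := h₂.eq_of_overlap h₂' hw₂ (hcb.trans hbd') (hcb'.trans hbd)
    rfl
  have hSS : #(Q (IsWordSpan w) (IsWordSpan w)) ≤ k ^ 2 := by
    refine card_le_sq_of_injOn (fun q => (w q.2.1, w q.1.1)) ?_
    rintro ⟨⟨a, b⟩, ⟨c, d⟩⟩ hq ⟨⟨a', b'⟩, ⟨c', d'⟩⟩ hq' he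
    obtain ⟨h₁, h₂, -⟩ := (mem_filter.1 hq).2
    obtain ⟨h₁', h₂', -⟩ := (mem_filter.1 hq').2
    obtain ⟨hw₂, hw⟩ := Prod.mk.inj he
    dsimp only at *
    obtain ⟨rfl, rfl⟩ := h₁.eq_of_letter_eq h₁' hw
    obtain ⟨rfl, rfl⟩ := h₂.eq_of_letter_eq h₂' hw₂
    rfl
  rw [← card_chordCrossings]
  refine (card_le_card hsub).trans ?_
  refine (card_union_le _ _).trans ?_
  have h₂ := card_union_le (Q (IsWordArc w) (IsWordSpan w))
    (Q (IsWordSpan w) (IsWordArc w) ∪ Q (IsWordSpan w) (IsWordSpan w))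
  have h₃ := card_union_le (Q (IsWordSpan w) (IsWordArc w)) (Q (IsWordSpan w) (IsWordSpan w))
  omega

theorem exists_isWordArc_of_lt {n k : ℕ} {w : Fin n → Fin k} {a b t : Fin n} (hat : a < t)
    (htb : t < b) (hab : w a = w b) (ht : w t ≠ w a) :
    ∃ a' b', IsWordArc w a' b' ∧ a' < t ∧ t < b' ∧ b' ≤ b ∧ w a' = w a := by
  classical
  obtain ⟨a', ha', hmax⟩ := exists_max_image (univ.filter fun i => i < t ∧ w i = w a) id
    ⟨a, by simp [hat]⟩
  obtain ⟨b', hb', hmin⟩ := exists_min_image (univ.filter fun i => t < i ∧ w i = w a) id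
    ⟨b, by simp [htb, hab]⟩
  simp only [mem_filter, mem_univ, true_and, id, and_imp] at ha' hb' hmax hmin
  refine ⟨a', b', ⟨ha'.1.trans hb'.1, ha'.2.trans hb'.2.symm, ?_⟩, ha'.1, hb'.1,
    hmin b htb hab.symm, ha'.2⟩
  rintro c hc ⟨h₁, h₂⟩
  rcases lt_trichotomy c t with h | h | h
  · exact absurd (hmax c h (hc.symm.trans ha'.2)) (not_le.2 h₁)
  · exact ht (h ▸ hc.symm.trans ha'.2)
  · exact absurd (hmin c h (hc.symm.trans ha'.2)) (not_le.2 h₂)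

theorem exists_isWordArc_right {n k : ℕ} {w : Fin n → Fin k} {t s : Fin n} (hts : t < s)
    (hs : w s = w t) : ∃ d, IsWordArc w t d := by
  classical
  obtain ⟨d, hd, hmin⟩ := exists_min_image (univ.filter fun i => t < i ∧ w i = w t) id
    ⟨s, by simp [hts, hs]⟩
  simp only [mem_filter, mem_univ, true_and, id, and_imp] at hd hmin
  exact ⟨d, hd.1, hd.2.symm, fun c hc h => absurd (hmin c h.1 hc.symm) (not_le.2 h.2)⟩

theorem totalRank_le_crc {n k : ℕ} [NeZero k] (w : Fin n → Fin k) :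
    totalRank w ≤ crc (fiberPartition w) + 2 * k ^ 2 := by
  classical
  let T₁ : Finset (Fin n × Fin k) := univ.filter fun p => ∀ s, p.1 < s → w s ≠ w p.1
  let T₂ : Finset (Fin n × Fin k) := univ.filter fun p =>
    (∀ a, a < p.1 → w a ≠ p.2) ∧ ∃ j, p.1 < j ∧ w j = p.2 ∧ ∀ i, p.1 < i → i ≤ j → w i ≠ w p.1
  have hsub : rankPairs w ⊆
      T₁ ∪ (T₂ ∪ (chordCrossings w).image fun q => (q.2.1, w q.1.1)) := by
    rintro ⟨t, x⟩ hp
    have hx : x ∈ gapLetters w t := (mem_filter.1 hp).2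
    by_cases hlast : ∀ s, t < s → w s ≠ w t
    · exact mem_union_left _ (by simpa [T₁] using hlast)
    refine mem_union_right _ ?_
    push Not at hlast
    obtain ⟨s, hts, hs⟩ := hlast
    obtain ⟨j, htj, rfl, hj⟩ := exists_of_mem_gapLetters hts hs hx
    by_cases hfirst : ∀ a, a < t → w a ≠ w j
    · exact mem_union_left _ (by
        simp only [T₂, mem_filter, mem_univ, true_and]
        exact ⟨hfirst, j, htj, rfl, hj⟩)
    refine mem_union_right _ ?_
    push Not at hfirst
    obtain ⟨a, hat, ha⟩ := hfirst
    obtain ⟨d, hd⟩ := exists_isWordArc_right hts hs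
    obtain ⟨a', b', hab, hat', htb', hbj, hw⟩ :=
      exists_isWordArc_of_lt hat htj ha (ha ▸ (hj j htj le_rfl).symm)
    refine mem_image.2 ⟨((a', b'), (t, d)), ?_, by simp [hw, ha]⟩
    refine mem_filter.2 ⟨mem_univ _, hab.isChord, hd.isChord, hat', htb', ?_⟩
    by_contra hlt
    exact hj d hd.1 ((not_lt.1 hlt).trans hbj) hd.2.1.symm
  have h₁ : #T₁ ≤ k ^ 2 := by
    refine card_le_sq_of_injOn (fun p => (w p.1, p.2)) ?_
    rintro ⟨t, x⟩ hp ⟨t', x'⟩ hp' he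
    have hp := (mem_filter.1 hp).2
    have hp' := (mem_filter.1 hp').2
    obtain ⟨hw, rfl⟩ := Prod.mk.inj he
    dsimp only at *
    rcases lt_trichotomy t t' with h | rfl | h
    · exact absurd hw.symm (hp _ h)
    · rfl
    · exact absurd hw (hp' _ h)
  have h₂ : #T₂ ≤ k ^ 2 := by
    refine card_le_sq_of_injOn (fun p => (w p.1, p.2)) ?_
    have aux : ∀ {t t' x}, (t, x) ∈ T₂ → (t', x) ∈ T₂ → w t = w t' → ¬ t < t' := by
      intro t t' x hp hp' hw h
      obtain ⟨-, j, htj, hjx, hj⟩ := (mem_filter.1 hp).2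
      obtain ⟨hfirst, -⟩ := (mem_filter.1 hp').2
      dsimp only at *
      exact hj t' h (not_lt.1 fun hlt => hfirst j hlt hjx) hw.symm
    rintro ⟨t, x⟩ hp ⟨t', x'⟩ hp' he
    obtain ⟨hw, rfl⟩ := Prod.mk.inj he
    exact Prod.ext (le_antisymm (not_lt.1 (aux hp' hp hw.symm)) (not_lt.1 (aux hp hp' hw))) rfl
  rw [← card_chordCrossings, ← card_rankPairs]
  refine (card_le_card hsub).trans ((card_union_le _ _).trans ?_)
  have h₃ := card_union_le T₂ ((chordCrossings w).image fun q => (q.2.1, w q.1.1))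
  have h₄ := card_image_le (s := chordCrossings w) (f := fun q => (q.2.1, w q.1.1))
  omega

theorem notMem_lettersBefore_self {k : ℕ} (v : ℕ → Fin k) (c : Fin k) :
    c ∉ lettersBefore v c := by
  rw [mem_lettersBefore]
  rintro ⟨j, hj, h⟩
  exact h j le_rfl hj

theorem card_lettersBefore_lt {k : ℕ} (v : ℕ → Fin k) (c : Fin k) : #(lettersBefore v c) < k := by
  have := card_lt_univ_of_notMem (notMem_lettersBefore_self v c)
  simpa using this

theorem card_lettersBefore_injective {k : ℕ} {v : ℕ → Fin k} (hv : Function.Surjective v) :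
    Function.Injective fun c => #(lettersBefore v c) := by
  classical
  let p : Fin k → ℕ := fun c => Nat.find (hv c)
  have hp : ∀ c, v (p c) = c := fun c => Nat.find_spec (hv c)
  have hpi : Function.Injective p := fun c c' h => by rw [← hp c, h, hp c']
  have hmem : ∀ c d, d ∈ lettersBefore v c ↔ p d < p c := by
    intro c d
    rw [mem_lettersBefore]
    constructor
    · rintro ⟨j, hj, h⟩
      refine (Nat.find_min' (hv d) hj).trans_lt (not_le.1 fun hle => h (p c) hle (hp c))
    · intro h
      exact ⟨p d, hp d, fun i hi => Nat.find_min (hv c) (hi.trans_lt h)⟩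
  have hlt : ∀ c c', p c < p c' → #(lettersBefore v c) < #(lettersBefore v c') := by
    intro c c' h
    refine card_lt_card (ssubset_iff_of_subset ?_ |>.2
      ⟨c, (hmem _ _).2 h, notMem_lettersBefore_self v c⟩)
    intro d hd
    exact (hmem _ _).2 (((hmem _ _).1 hd).trans h)
  intro c c' h
  rcases lt_trichotomy (p c) (p c') with h' | h' | h'
  · exact absurd h (hlt _ _ h').ne
  · exact hpi h'
  · exact absurd h (hlt _ _ h').ne'

theorem sum_card_lettersBefore {k : ℕ} {v : ℕ → Fin k} (hv : Function.Surjective v) (g : ℕ → ℝ) :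
    ∑ c, g #(lettersBefore v c) = ∑ r ∈ range k, g r := by
  let f : Fin k → Fin k := fun c => ⟨#(lettersBefore v c), card_lettersBefore_lt v c⟩
  have hf : Function.Injective f := fun c c' h =>
    card_lettersBefore_injective hv (congrArg Fin.val h)
  rw [← Fin.sum_univ_eq_sum_range]
  exact (Finite.injective_iff_bijective.1 hf).sum_comp fun r : Fin k => g r

theorem extendWord_cons_succ {n k : ℕ} [NeZero k] (c : Fin k) (w : Fin n → Fin k) (i : ℕ) :
    extendWord (Fin.cons c w : Fin (n + 1) → Fin k) (i + 1) = extendWord w i := by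
  unfold extendWord
  by_cases h : i < n
  · simp only [h, Nat.add_lt_add_iff_right, dif_pos]
    exact Fin.cons_succ (α := fun _ => Fin k) c w ⟨i, h⟩
  · simp [h]

theorem totalRank_cons {n k : ℕ} [NeZero k] (c : Fin k) (w : Fin n → Fin k) :
    totalRank (Fin.cons c w : Fin (n + 1) → Fin k) =
      #(lettersBefore (extendWord w) c) + totalRank w := by
  rw [totalRank, Fin.sum_univ_succ, totalRank]
  congr 1
  · simp only [gapLetters, Fin.val_zero, zero_add, Fin.cons_zero, add_comm 1,
      extendWord_cons_succ]
  · refine sum_congr rfl fun t _ => ?_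
    simp only [gapLetters, Fin.val_succ, Fin.cons_succ, add_right_comm _ 1,
      extendWord_cons_succ]

theorem totalRank_le {n k : ℕ} [NeZero k] (w : Fin n → Fin k) : totalRank w ≤ n * k := by
  simpa [totalRank] using sum_le_card_nsmul univ (fun t => #(gapLetters w t)) k
    fun t _ => (card_lettersBefore_lt _ _).le

theorem sum_words_succ {n k : ℕ} (F : (Fin (n + 1) → Fin k) → ℝ) :
    ∑ w, F w = ∑ w : Fin n → Fin k, ∑ c, F (Fin.cons c w) := by
  rw [← (Fin.consEquiv fun _ => Fin k).sum_comp F, Fintype.sum_prod_type, sum_comm]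
  rfl

theorem sum_range_sub_mean (k : ℕ) : ∑ r ∈ range k, ((r : ℝ) - ((k : ℝ) - 1) / 2) = 0 := by
  have h : ∑ r ∈ range k, (r : ℝ) = k * (k - 1) / 2 := by
    induction k with
    | zero => simp
    | succ k ih => rw [sum_range_succ, ih]; push_cast; ring
  rw [sum_sub_distrib, h, sum_const, card_range, nsmul_eq_mul]
  ring

theorem sum_range_sub_mean_sq (k : ℕ) :
    ∑ r ∈ range k, ((r : ℝ) - ((k : ℝ) - 1) / 2) ^ 2 = k * ((k : ℝ) ^ 2 - 1) / 12 := by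
  have h (x : ℝ) : ∑ r ∈ range k, ((r : ℝ) - x) ^ 2 =
      k * (k - 1) * (2 * k - 1) / 6 - x * k * (k - 1) + k * x ^ 2 := by
    induction k with
    | zero => simp
    | succ k ih => rw [sum_range_succ, ih]; push_cast; ring
  rw [h]
  ring

theorem sum_totalRank_sub_mean (n k : ℕ) [NeZero k] :
    ∑ w : Fin n → Fin k, ((totalRank w : ℝ) - n * (((k : ℝ) - 1) / 2)) = 0 := by
  induction n with
  | zero => simp [totalRank]
  | succ n ih =>
    rw [sum_words_succ]
    have h (w : Fin n → Fin k) :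
        ∑ c, ((totalRank (Fin.cons c w : Fin (n + 1) → Fin k) : ℝ) -
          ((n + 1 : ℕ) : ℝ) * (((k : ℝ) - 1) / 2)) =
        k * ((totalRank w : ℝ) - n * (((k : ℝ) - 1) / 2)) := by
      simp only [totalRank_cons]
      rw [sum_card_lettersBefore (extendWord_surjective w)
        fun r => (((r + totalRank w : ℕ) : ℝ) - ((n + 1 : ℕ) : ℝ) * (((k : ℝ) - 1) / 2))]
      have : ∀ r ∈ range k,
          (((r + totalRank w : ℕ) : ℝ) - ((n + 1 : ℕ) : ℝ) * (((k : ℝ) - 1) / 2)) =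
          ((r : ℝ) - ((k : ℝ) - 1) / 2) + ((totalRank w : ℝ) - n * (((k : ℝ) - 1) / 2)) := by
        intro r _
        push_cast
        ring
      rw [sum_congr rfl this, sum_add_distrib, sum_range_sub_mean,
        sum_const, card_range, nsmul_eq_mul, zero_add]
    rw [sum_congr rfl fun w _ => h w, ← mul_sum, ih, mul_zero]

theorem sum_totalRank_sub_mean_sq (n k : ℕ) [NeZero k] :
    ∑ w : Fin n → Fin k, ((totalRank w : ℝ) - n * (((k : ℝ) - 1) / 2)) ^ 2 =
      (k : ℝ) ^ n * (((k : ℝ) ^ 2 - 1) * n / 12) := by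
  induction n with
  | zero => simp [totalRank]
  | succ n ih =>
    rw [sum_words_succ]
    have h (w : Fin n → Fin k) :
        ∑ c, ((totalRank (Fin.cons c w : Fin (n + 1) → Fin k) : ℝ) -
          ((n + 1 : ℕ) : ℝ) * (((k : ℝ) - 1) / 2)) ^ 2 =
        k * ((k : ℝ) ^ 2 - 1) / 12 +
          k * ((totalRank w : ℝ) - n * (((k : ℝ) - 1) / 2)) ^ 2 := by
      simp only [totalRank_cons]
      rw [sum_card_lettersBefore (extendWord_surjective w)
        fun r => (((r + totalRank w : ℕ) : ℝ) - ((n + 1 : ℕ) : ℝ) * (((k : ℝ) - 1) / 2)) ^ 2]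
      have : ∀ r ∈ range k,
          (((r + totalRank w : ℕ) : ℝ) - ((n + 1 : ℕ) : ℝ) * (((k : ℝ) - 1) / 2)) ^ 2 =
          ((r : ℝ) - ((k : ℝ) - 1) / 2) ^ 2 +
            2 * ((totalRank w : ℝ) - n * (((k : ℝ) - 1) / 2)) * ((r : ℝ) - ((k : ℝ) - 1) / 2) +
            ((totalRank w : ℝ) - n * (((k : ℝ) - 1) / 2)) ^ 2 := by
        intro r _
        push_cast
        ring
      rw [sum_congr rfl this, sum_add_distrib, sum_add_distrib, ← mul_sum, sum_range_sub_mean,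
        sum_range_sub_mean_sq]
      simp
    rw [sum_congr rfl fun w _ => h w, sum_add_distrib, ← mul_sum, ih]
    simp only [sum_const, card_univ, Fintype.card_fun, Fintype.card_fin, nsmul_eq_mul]
    push_cast
    ring

theorem card_compl_surjWords_le (n k : ℕ) : #(surjWords n k)ᶜ ≤ k * (k - 1) ^ n := by
  classical
  have hsub : (surjWords n k)ᶜ ⊆
      univ.biUnion fun c : Fin k => Fintype.piFinset fun _ : Fin n => univ.erase c := by
    intro w hw
    have hw : ¬ Function.Surjective w := fun h =>
      mem_compl.1 hw (mem_filter.2 ⟨mem_univ _, h⟩)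
    simpa [Function.Surjective] using hw
  refine (card_le_card hsub).trans (card_biUnion_le.trans ?_)
  simp [Fintype.card_piFinset, card_erase_of_mem]

theorem variance_perturbation {α : Type*} (W : Finset α) (hW : W.Nonempty) (x y : α → ℝ)
    (m V c s : ℝ) (hs : 0 < s) (hV : V + 1 ≤ s ^ 2) (hc : ∀ w ∈ W, |y w - x w| ≤ c)
    (h₁ : |∑ w ∈ W, (x w - m)| ≤ #W) (h₂ : |∑ w ∈ W, (x w - m) ^ 2 - #W * V| ≤ #W) :
    |(∑ w ∈ W, y w ^ 2) / #W - ((∑ w ∈ W, y w) / #W) ^ 2 - V| ≤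
      2 * c * s + c ^ 2 + (1 + c) ^ 2 + 1 := by
  have hN : (0 : ℝ) < #W := by exact_mod_cast hW.card_pos
  have hc0 : 0 ≤ c := by
    obtain ⟨w, hw⟩ := hW
    exact (abs_nonneg _).trans (hc w hw)
  set N : ℝ := ((#W : ℕ) : ℝ)
  set A := ∑ w ∈ W, (x w - m) ^ 2
  set A₁ := ∑ w ∈ W, (x w - m)
  set B := ∑ w ∈ W, (y w - m) ^ 2
  set B₁ := ∑ w ∈ W, (y w - m)
  have hB₁ : B₁ = (∑ w ∈ W, y w) - N * m := by simp [B₁, N, sum_sub_distrib]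
  have hB : B = (∑ w ∈ W, y w ^ 2) - 2 * m * (∑ w ∈ W, y w) + N * m ^ 2 := by
    simp only [B, sub_sq, sum_add_distrib, sum_sub_distrib, sum_const, nsmul_eq_mul, mul_sum, N]
    congr 2
    exact sum_congr rfl fun w _ => by ring
  have hvar : (∑ w ∈ W, y w ^ 2) / N - ((∑ w ∈ W, y w) / N) ^ 2 = B / N - (B₁ / N) ^ 2 := by
    rw [hB, hB₁]
    field_simp
    ring
  have hdiff₁ : |B₁ - A₁| ≤ N * c := by
    rw [← sum_sub_distrib]
    refine (abs_sum_le_sum_abs _ _).trans ?_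
    rw [← nsmul_eq_mul]
    exact sum_le_card_nsmul _ _ _ fun w hw => by simpa using hc w hw
  have hdiff : |B - A| ≤ c / s * A + N * (c * s + c ^ 2) := by
    rw [← sum_sub_distrib]
    refine (abs_sum_le_sum_abs _ _).trans ?_
    rw [← nsmul_eq_mul, ← sum_const, mul_sum, ← sum_add_distrib]
    refine sum_le_sum fun w hw => ?_
    have hz := hc w hw
    have hfac : (y w - m) ^ 2 - (x w - m) ^ 2 =
        (y w - x w) * (2 * (x w - m) + (y w - x w)) := by ring
    have ham : 2 * |x w - m| ≤ (x w - m) ^ 2 / s + s := by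
      have hsq := sq_nonneg (|x w - m| - s)
      have habs := sq_abs (x w - m)
      rw [div_add' _ _ _ hs.ne', le_div_iff₀ hs]
      nlinarith
    have htri : |2 * (x w - m) + (y w - x w)| ≤ (x w - m) ^ 2 / s + s + c := by
      refine (abs_add_le _ _).trans ?_
      rw [abs_mul, abs_two]
      linarith
    rw [hfac, abs_mul]
    calc |y w - x w| * |2 * (x w - m) + (y w - x w)|
        ≤ c * ((x w - m) ^ 2 / s + s + c) :=
          mul_le_mul hz htri (abs_nonneg _) hc0
      _ = c / s * (x w - m) ^ 2 + (c * s + c ^ 2) := by ring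
  have hA : A ≤ N * s ^ 2 := by
    have := (abs_le.1 h₂).2
    nlinarith
  have hcA : c / s * A ≤ N * (c * s) := by
    calc c / s * A ≤ c / s * (N * s ^ 2) := mul_le_mul_of_nonneg_left hA (by positivity)
      _ = N * (c * s) := by field_simp
  have hBV : |B / N - V| ≤ 2 * c * s + c ^ 2 + 1 := by
    have : B / N - V = (B - N * V) / N := by field_simp
    rw [this, abs_div, abs_of_pos hN, div_le_iff₀ hN]
    have := abs_add_le (B - A) (A - N * V)
    rw [sub_add_sub_cancel] at this
    nlinarith
  have hB₁N : |B₁ / N| ≤ 1 + c := by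
    rw [abs_div, abs_of_pos hN, div_le_iff₀ hN]
    have := abs_add_le (B₁ - A₁) A₁
    rw [sub_add_cancel] at this
    linarith
  have hsq : (B₁ / N) ^ 2 ≤ (1 + c) ^ 2 := by
    rw [← sq_abs]
    exact pow_le_pow_left₀ (abs_nonneg _) hB₁N 2
  rw [hvar]
  have h := abs_le.1 hBV
  rw [abs_le]
  constructor
  · linarith [h.1]
  · linarith [h.2, sq_nonneg (B₁ / N), sq_nonneg (1 + c)]

/-- The variance estimate when all but a small proportion of the words are surjective. -/
theorem VarY_bound {n k : ℕ} (hn : 1 ≤ n) (hk : 1 ≤ k) (hkn : (k : ℝ) ≤ √n)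
    (hsmall : 2 * ((k : ℝ) * ((k : ℝ) - 1) ^ n) * ((n : ℝ) * k) ^ 2 ≤ (k : ℝ) ^ n) :
    |VarY n k - ((k : ℝ) ^ 2 - 1) * n / 12| ≤ 38 * (k : ℝ) ^ 3 * √n := by
  classical
  have : NeZero k := ⟨by omega⟩
  have hn' : (1 : ℝ) ≤ n := by exact_mod_cast hn
  have hk' : (1 : ℝ) ≤ k := by exact_mod_cast hk
  set m : ℝ := n * (((k : ℝ) - 1) / 2) with hm
  set V : ℝ := ((k : ℝ) ^ 2 - 1) * n / 12 with hVdef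
  set W := surjWords n k
  set L : ℝ := (n : ℝ) * k with hL
  have hL1 : 1 ≤ L := one_le_mul_of_one_le_of_one_le hn' hk'
  have hD : (#Wᶜ : ℝ) ≤ (k : ℝ) * ((k : ℝ) - 1) ^ n := by
    have := card_compl_surjWords_le n k
    rw [← Nat.cast_one, ← Nat.cast_sub hk]
    exact_mod_cast this
  have htot : (#W : ℝ) + #Wᶜ = (k : ℝ) ^ n := by
    have := card_add_card_compl W
    rw [Fintype.card_fun, Fintype.card_fin, Fintype.card_fin] at this
    exact_mod_cast this
  have hDL : 2 * (#Wᶜ : ℝ) * L ^ 2 ≤ #W + #Wᶜ := by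
    rw [htot]
    refine le_trans ?_ hsmall
    gcongr
  have hL2 : 1 ≤ L ^ 2 := one_le_pow₀ hL1
  have hD0 : (0 : ℝ) ≤ #Wᶜ := Nat.cast_nonneg _
  have hDW : (#Wᶜ : ℝ) * L ^ 2 ≤ #W := by nlinarith
  have hdev : ∀ w : Fin n → Fin k, |(totalRank w : ℝ) - m| ≤ L := by
    intro w
    have h : (totalRank w : ℝ) ≤ n * k := by exact_mod_cast totalRank_le w
    have h0 : (0 : ℝ) ≤ totalRank w := Nat.cast_nonneg _
    rw [abs_le]
    constructor <;> nlinarith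
  have hWpos : W.Nonempty := by
    rw [nonempty_iff_ne_empty]
    intro h
    have hzero : (#W : ℝ) = 0 := by simp [h]
    have : (0 : ℝ) < (k : ℝ) ^ n := by positivity
    nlinarith
  have h₁ : |∑ w ∈ W, ((totalRank w : ℝ) - m)| ≤ #W := by
    have hsplit := sum_add_sum_compl W fun w => (totalRank w : ℝ) - m
    rw [sum_totalRank_sub_mean] at hsplit
    rw [eq_neg_of_add_eq_zero_left hsplit, abs_neg]
    refine (abs_sum_le_sum_abs _ _).trans ((sum_le_card_nsmul _ _ L fun w _ => hdev w).trans ?_)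
    rw [nsmul_eq_mul]
    nlinarith
  have hV0 : 0 ≤ V := by
    have : 0 ≤ (k : ℝ) ^ 2 - 1 := by nlinarith
    positivity
  have hVL : V ≤ L ^ 2 := by
    rw [hVdef, hL, mul_pow]
    have : (n : ℝ) ≤ n ^ 2 := by nlinarith
    nlinarith [sq_nonneg (k : ℝ)]
  have h₂ : |∑ w ∈ W, ((totalRank w : ℝ) - m) ^ 2 - #W * V| ≤ #W := by
    have hsplit := sum_add_sum_compl W fun w => ((totalRank w : ℝ) - m) ^ 2
    rw [sum_totalRank_sub_mean_sq, ← htot, ← hVdef, add_mul] at hsplit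
    have hrest0 : 0 ≤ ∑ w ∈ Wᶜ, ((totalRank w : ℝ) - m) ^ 2 :=
      sum_nonneg fun w _ => sq_nonneg _
    have hrest : ∑ w ∈ Wᶜ, ((totalRank w : ℝ) - m) ^ 2 ≤ #Wᶜ * L ^ 2 := by
      rw [← nsmul_eq_mul]
      refine sum_le_card_nsmul _ _ _ fun w _ => ?_
      rw [← sq_abs]
      exact pow_le_pow_left₀ (abs_nonneg _) (hdev w) 2
    have hDV : (#Wᶜ : ℝ) * V ≤ #Wᶜ * L ^ 2 := mul_le_mul_of_nonneg_left hVL hD0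
    have hDV0 : 0 ≤ (#Wᶜ : ℝ) * V := mul_nonneg hD0 hV0
    rw [abs_le]
    constructor <;> linarith
  have hsqrt : √(n : ℝ) ^ 2 = n := Real.sq_sqrt (by linarith)
  have hVs : V + 1 ≤ (2 * k * √n) ^ 2 := by
    rw [mul_pow, hsqrt, hVdef]
    have : 1 ≤ (k : ℝ) ^ 2 * n := one_le_mul_of_one_le_of_one_le (one_le_pow₀ hk') hn'
    nlinarith
  have hs : 0 < 2 * (k : ℝ) * √n := by
    have : 0 < √(n : ℝ) := by linarith
    positivity
  have hc : ∀ w ∈ W, |(crc (fiberPartition w) : ℝ) - totalRank w| ≤ 3 * (k : ℝ) ^ 2 := by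
    intro w _
    have hu : (crc (fiberPartition w) : ℝ) ≤ totalRank w + 3 * (k : ℝ) ^ 2 := by
      exact_mod_cast crc_le_totalRank w
    have hl : (totalRank w : ℝ) ≤ crc (fiberPartition w) + 2 * (k : ℝ) ^ 2 := by
      exact_mod_cast totalRank_le_crc w
    rw [abs_le]
    constructor <;> nlinarith
  rw [VarY_eq_surjWords]
  refine (variance_perturbation W hWpos (fun w => (totalRank w : ℝ))
    (fun w => (crc (fiberPartition w) : ℝ)) m V (3 * (k : ℝ) ^ 2) (2 * k * √n) hs hVs hc h₁
    h₂).trans ?_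
  have h4 : (k : ℝ) ^ 4 ≤ (k : ℝ) ^ 3 * √n := by
    rw [pow_succ]
    exact mul_le_mul_of_nonneg_left hkn (by positivity)
  have h24 : (k : ℝ) ^ 2 ≤ (k : ℝ) ^ 4 := pow_le_pow_right₀ hk' (by norm_num)
  have h14 : 1 ≤ (k : ℝ) ^ 4 := one_le_pow₀ hk'
  nlinarith

theorem eventually_surjective_dominates (k : ℕ → ℕ) (hk1 : ∀ n, 1 ≤ k n)
    (hk2 : ∀ᶠ n : ℕ in Filter.atTop, (k n : ℝ) ≤ √n) :
    ∀ᶠ n : ℕ in Filter.atTop,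
      2 * ((k n : ℝ) * ((k n : ℝ) - 1) ^ n) * ((n : ℝ) * k n) ^ 2 ≤ (k n : ℝ) ^ n := by
  have hlim : Filter.Tendsto (fun n : ℕ => √(n : ℝ) ^ 7 * Real.exp (-√(n : ℝ)))
      Filter.atTop (nhds 0) :=
    (Real.tendsto_pow_mul_exp_neg_atTop_nhds_zero 7).comp
      (Real.tendsto_sqrt_atTop.comp tendsto_natCast_atTop_atTop)
  filter_upwards [hk2, hlim.eventually_le_const (show (0 : ℝ) < 1 / 2 by norm_num)] with n hkn hexp
  have hk : (1 : ℝ) ≤ k n := by exact_mod_cast hk1 n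
  have hk0 : (0 : ℝ) < k n := by linarith
  have hsqrt : √(n : ℝ) ^ 2 = n := Real.sq_sqrt (Nat.cast_nonneg n)
  have hpow : ((k n : ℝ) - 1) ^ n ≤ (k n : ℝ) ^ n * Real.exp (-√(n : ℝ)) := by
    have h1 : (k n : ℝ) - 1 ≤ k n * Real.exp (-(1 / k n)) := by
      have := Real.add_one_le_exp (-(1 / (k n : ℝ)))
      calc (k n : ℝ) - 1 = k n * (-(1 / k n) + 1) := by field_simp; ring
        _ ≤ _ := mul_le_mul_of_nonneg_left this hk0.le
    refine (pow_le_pow_left₀ (by linarith) h1 n).trans ?_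
    rw [mul_pow, ← Real.exp_nat_mul]
    refine mul_le_mul_of_nonneg_left (Real.exp_le_exp.2 ?_) (by positivity)
    rw [mul_neg, neg_le_neg_iff, mul_one_div, le_div_iff₀ hk0]
    nlinarith [Real.sqrt_nonneg (n : ℝ)]
  have hk3 : (k n : ℝ) ^ 3 ≤ √(n : ℝ) ^ 3 := pow_le_pow_left₀ hk0.le hkn 3
  calc 2 * ((k n : ℝ) * ((k n : ℝ) - 1) ^ n) * ((n : ℝ) * k n) ^ 2
      = 2 * ((k n : ℝ) ^ 3 * (n : ℝ) ^ 2) * ((k n : ℝ) - 1) ^ n := by ring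
    _ ≤ 2 * (√(n : ℝ) ^ 3 * (n : ℝ) ^ 2) * ((k n : ℝ) ^ n * Real.exp (-√(n : ℝ))) := by
      refine mul_le_mul (by gcongr) hpow (pow_nonneg (by linarith) n) (by positivity)
    _ = (k n : ℝ) ^ n * (2 * (√(n : ℝ) ^ 7 * Real.exp (-√(n : ℝ)))) := by
      rw [← hsqrt]
      rw [Real.sqrt_sq (Real.sqrt_nonneg _)]
      ring
    _ ≤ (k n : ℝ) ^ n * 1 := by
      refine mul_le_mul_of_nonneg_left (by linarith) (by positivity)
    _ = (k n : ℝ) ^ n := mul_one _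

/-- Asymptotics of the variance of the circular crossing number for `k_n = o(√n)`. -/
theorem var_crc_asymptotics (k : ℕ → ℕ) (hk1 : ∀ n, 1 ≤ k n)
    (hk2 : Filter.Tendsto (fun n : ℕ => (k n : ℝ) / Real.sqrt n) Filter.atTop (nhds 0)) :
    ∃ C : ℝ, 0 < C ∧ ∀ n ≥ 2,
      |VarY n (k n) - ((k n : ℝ) ^ 2 - 1) * (n : ℝ) / 12|
        ≤ C * (k n : ℝ) ^ 3 * Real.sqrt n := by
  have hle : ∀ᶠ n : ℕ in Filter.atTop, (k n : ℝ) ≤ √n := by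
    filter_upwards [hk2.eventually_le_const zero_lt_one, Filter.eventually_ge_atTop 1] with n h hn
    have : 0 < √(n : ℝ) := Real.sqrt_pos.2 (by exact_mod_cast hn)
    simpa using (div_le_iff₀ this).1 h
  obtain ⟨M, hM⟩ := Filter.eventually_atTop.1
    (hle.and (eventually_surjective_dominates k hk1 hle))
  let E : ℕ → ℝ := fun n => |VarY n (k n) - ((k n : ℝ) ^ 2 - 1) * (n : ℝ) / 12|
  have hE : ∀ n, 0 ≤ E n := fun n => abs_nonneg _
  have hsum : 0 ≤ ∑ i ∈ range M, E i := sum_nonneg fun i _ => hE i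
  refine ⟨38 + ∑ i ∈ range M, E i, by linarith, fun n hn => ?_⟩
  have hk : (1 : ℝ) ≤ (k n : ℝ) ^ 3 := one_le_pow₀ (by exact_mod_cast hk1 n)
  have hs : 1 ≤ √(n : ℝ) := Real.one_le_sqrt.2 (by exact_mod_cast (by omega : 1 ≤ n))
  have hks : 1 ≤ (k n : ℝ) ^ 3 * √n := one_le_mul_of_one_le_of_one_le hk hs
  rw [mul_assoc]
  rcases lt_or_ge n M with h | h
  · have hn : E n ≤ ∑ i ∈ range M, E i :=
      single_le_sum (fun i _ => hE i) (mem_range.2 h)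
    calc E n ≤ (38 + ∑ i ∈ range M, E i) * 1 := by linarith
      _ ≤ _ := mul_le_mul_of_nonneg_left hks (by linarith)
  · have hb := VarY_bound (by omega) (hk1 n) (hM n h).1 (hM n h).2
    rw [mul_assoc] at hb
    exact hb.trans (mul_le_mul_of_nonneg_right (by linarith) (by linarith))
end
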